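/- arXiv:1007.1901 — 2 statements merged into one kernel-verified Lean document; each statement's English description precedes it below -/
import Mathlib

section
/- Every permutation σ of size n ≥ 2 admits a unique decomposition σ = σ_1 ∨ σ_2 ∨ … ∨ σ_r (the operation ∨ applied left-nestedly) in which every factor σ_i is a non-secable permutation. -/
/-- A list of naturals is a permutation of `{1,…,n}` written as a word `σ₁ σ₂ … σ_n`. -/
def IsPermList (σ : List ℕ) : Prop := σ.Perm (List.range' 1 σ.length)

/-- The permutation `α ∨ β ∈ S_{k+l−1}` for `α ∈ S_k`, `β ∈ S_l`: the first `k` letters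
are `α_i + β₁ − 1` if `α_i ≤ α_k` and `α_i + l − 1` if `α_i > α_k`, followed, for
`2 ≤ i ≤ l`, by `β_i` if `β_i < β₁` and `β_i + α_k − 1` if `β_i ≥ β₁`. -/
def vee (α β : List ℕ) : List ℕ :=
  (α.map (fun x => if x ≤ α.getD (α.length - 1) 0 then x + β.getD 0 0 - 1
      else x + β.length - 1)) ++
    ((β.drop 1).map (fun y => if y < β.getD 0 0 then y
      else y + α.getD (α.length - 1) 0 - 1))

/-- A finite set of naturals is an interval of integers (a set of consecutive values). -/
def IsIntervalSet (s : Finset ℕ) : Prop :=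
  ∀ a ∈ s, ∀ b ∈ s, ∀ c, a ≤ c → c ≤ b → c ∈ s

/-- The permutation `α ∈ S_n` is secable at `k` (for `2 ≤ k < n`): the set
`{α₁,…,α_k}` is, up to order, the union of an interval of integers with maximal
value `α_k` and another interval of integers that is either empty or has maximal
value `n` (letters are 1-indexed, so `α_k = α.getD (k-1) 0`). -/
def SecableAt (α : List ℕ) (k : ℕ) : Prop :=
  ∃ s t : Finset ℕ, (α.take k).toFinset = s ∪ t ∧
    IsIntervalSet s ∧ α.getD (k - 1) 0 ∈ s ∧ (∀ x ∈ s, x ≤ α.getD (k - 1) 0) ∧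
    IsIntervalSet t ∧ (t = ∅ ∨ (α.length ∈ t ∧ ∀ x ∈ t, x ≤ α.length))

/-- A permutation of size `n ≥ 2` is non-secable if it is secable at no `k` with
`2 ≤ k < n`. -/
def NonSecable (α : List ℕ) : Prop :=
  2 ≤ α.length ∧ ∀ k, 2 ≤ k → k < α.length → ¬ SecableAt α k

theorem isPermList_iff {σ : List ℕ} :
    IsPermList σ ↔ σ.Nodup ∧ ∀ x ∈ σ, 1 ≤ x ∧ x ≤ σ.length := by
  constructor
  · intro h
    refine ⟨h.nodup_iff.2 List.nodup_range', fun x hx => ?_⟩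
    have := h.mem_iff.1 hx
    rw [List.mem_range'_1] at this
    omega
  · rintro ⟨hn, h⟩
    refine (hn.subperm fun x hx => ?_).perm_of_length_le (by simp)
    have := h x hx
    rw [List.mem_range'_1]
    omega

theorem IsPermList.mem_iff {σ : List ℕ} (h : IsPermList σ) {x : ℕ} :
    x ∈ σ ↔ 1 ≤ x ∧ x ≤ σ.length := by
  rw [List.Perm.mem_iff h, List.mem_range'_1]
  omega

theorem getD_pred_mem_take {σ : List ℕ} {k : ℕ} (hk : 1 ≤ k) (hkn : k ≤ σ.length) :
    σ.getD (k - 1) 0 ∈ σ.take k := by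
  rw [List.getD_eq_getElem _ _ (by omega), List.mem_take_iff_getElem]
  exact ⟨k - 1, by omega, rfl⟩

/-- The first `k` letters of `σ` are the values in `[p, w] ∪ [q, n]`, where `w` is the
`k`-th letter. -/
def CutWith (σ : List ℕ) (k p q : ℕ) : Prop :=
  1 ≤ p ∧ p ≤ σ.getD (k - 1) 0 ∧ σ.getD (k - 1) 0 < q ∧ q ≤ σ.length + 1 ∧
    ∀ x, x ∈ σ.take k ↔ (p ≤ x ∧ x ≤ σ.getD (k - 1) 0) ∨ (q ≤ x ∧ x ≤ σ.length)

theorem secableAt_iff {σ : List ℕ} (h : IsPermList σ) {k : ℕ} (hk : 1 ≤ k)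
    (hkn : k ≤ σ.length) : SecableAt σ k ↔ ∃ p q, CutWith σ k p q := by
  unfold SecableAt CutWith
  have hw := h.mem_iff.1 (List.mem_of_mem_take (getD_pred_mem_take hk hkn))
  have hpos : ∀ x ∈ σ.take k, 1 ≤ x := fun x hx => (h.mem_iff.1 (List.mem_of_mem_take hx)).1
  set w := σ.getD (k - 1) 0
  constructor
  · rintro ⟨s, t, hst, hs, hws, hsw, ht, htn⟩
    have hmem : ∀ x, x ∈ σ.take k ↔ x ∈ s ∨ x ∈ t := fun x => by
      rw [← List.mem_toFinset, hst, Finset.mem_union]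
    have hs' : ∀ x, x ∈ s ↔ s.min' ⟨w, hws⟩ ≤ x ∧ x ≤ w := fun x =>
      ⟨fun hx => ⟨s.min'_le _ hx, hsw x hx⟩,
        fun hx => hs _ (s.min'_mem ⟨w, hws⟩) _ hws _ hx.1 hx.2⟩
    have hp := hpos _ ((hmem _).2 (.inl (s.min'_mem ⟨w, hws⟩)))
    have hpw := s.min'_le _ hws
    generalize s.min' ⟨w, hws⟩ = p at *
    rcases htn with rfl | ⟨hnt, htn⟩
    · refine ⟨p, σ.length + 1, hp, hpw, by omega, le_rfl, fun x => ?_⟩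
      rw [hmem, hs']
      simp only [Finset.notMem_empty, or_false]
      omega
    · have ht' : ∀ x, x ∈ t ↔ t.min' ⟨_, hnt⟩ ≤ x ∧ x ≤ σ.length := fun x =>
        ⟨fun hx => ⟨t.min'_le _ hx, htn x hx⟩,
          fun hx => ht _ (t.min'_mem ⟨_, hnt⟩) _ hnt _ hx.1 hx.2⟩
      have hm := hpos _ ((hmem _).2 (.inr (t.min'_mem ⟨_, hnt⟩)))
      have hmn := t.min'_le _ hnt
      generalize t.min' ⟨_, hnt⟩ = m at *
      refine ⟨min p m, max m (w + 1), ?_⟩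
      by_cases hmw : m ≤ w
      · refine ⟨by omega, by omega, by omega, by omega, fun x => ?_⟩
        rw [hmem, hs', ht']
        omega
      · refine ⟨by omega, by omega, by omega, by omega, fun x => ?_⟩
        rw [hmem, hs', ht']
        omega
  · rintro ⟨p, q, hp, hpw, hwq, hq, hmem⟩
    refine ⟨Finset.Icc p w, Finset.Icc q σ.length, ?_, ?_, ?_, ?_, ?_, ?_⟩
    · ext x
      simp [hmem]
    · intro a ha b hb c
      simp only [Finset.mem_Icc] at *
      omega
    · simpa using hpw
    · intro x hx
      exact (Finset.mem_Icc.1 hx).2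
    · intro a ha b hb c
      simp only [Finset.mem_Icc] at *
      omega
    · by_cases hqn : q ≤ σ.length
      · exact .inr ⟨by simpa using hqn, fun x hx => (Finset.mem_Icc.1 hx).2⟩
      · exact .inl (Finset.Icc_eq_empty hqn)

/-- The relabelling of the left factor of `vee`, for last letter `a`, first letter `b` and
size `l` of the right factor. -/
def veeLeft (a b l x : ℕ) : ℕ := if x ≤ a then x + b - 1 else x + l - 1

/-- The relabelling of the right factor of `vee`. -/
def veeRight (a b y : ℕ) : ℕ := if y < b then y else y + a - 1

theorem veeLeft_injective {a b l : ℕ} (hb : 1 ≤ b) (hbl : b ≤ l) :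
    Function.Injective (veeLeft a b l) := by
  intro x y h
  unfold veeLeft at h
  split_ifs at h <;> omega

theorem veeRight_injective {a b : ℕ} (ha : 1 ≤ a) : Function.Injective (veeRight a b) := by
  intro x y h
  unfold veeRight at h
  split_ifs at h <;> omega

theorem vee_cons (α t : List ℕ) (b : ℕ) :
    vee α (b :: t) = α.map (veeLeft (α.getD (α.length - 1) 0) b (t.length + 1)) ++
      t.map (veeRight (α.getD (α.length - 1) 0) b) := rfl

theorem length_vee_cons (α t : List ℕ) (b : ℕ) :
    (vee α (b :: t)).length = α.length + t.length := by
  simp [vee_cons]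

theorem IsPermList.head_bounds {b : ℕ} {t : List ℕ} (h : IsPermList (b :: t)) :
    1 ≤ b ∧ b ≤ t.length + 1 := by
  simpa using h.mem_iff.1 List.mem_cons_self

theorem IsPermList.last_bounds {α : List ℕ} (h : IsPermList α) (h1 : 1 ≤ α.length) :
    1 ≤ α.getD (α.length - 1) 0 ∧ α.getD (α.length - 1) 0 ≤ α.length :=
  h.mem_iff.1 (List.mem_of_mem_take (getD_pred_mem_take h1 le_rfl))

theorem IsPermList.vee_cons {α t : List ℕ} {b : ℕ} (hα : IsPermList α) (h1 : 1 ≤ α.length)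
    (hβ : IsPermList (b :: t)) : IsPermList (vee α (b :: t)) := by
  have hb := hβ.head_bounds
  have ha := hα.last_bounds h1
  rw [isPermList_iff, length_vee_cons, _root_.vee_cons]
  generalize α.getD (α.length - 1) 0 = a at *
  have hβ' := isPermList_iff.1 hβ
  simp only [List.nodup_cons, List.length_cons] at hβ'
  have hne : ∀ y ∈ t, y ≠ b := fun y hy e => hβ'.1.1 (e ▸ hy)
  constructor
  · rw [List.nodup_append]
    refine ⟨(isPermList_iff.1 hα).1.map (veeLeft_injective hb.1 hb.2),
      hβ'.1.2.map (veeRight_injective ha.1), ?_⟩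
    simp only [List.mem_map]
    rintro _ ⟨x, hx, rfl⟩ _ ⟨y, hy, rfl⟩
    have := hα.mem_iff.1 hx
    have := hβ'.2 y (List.mem_cons_of_mem _ hy)
    have := hne y hy
    unfold veeLeft veeRight
    split_ifs <;> omega
  · simp only [List.mem_append, List.mem_map]
    rintro _ (⟨x, hx, rfl⟩ | ⟨y, hy, rfl⟩)
    · have := hα.mem_iff.1 hx
      unfold veeLeft
      split_ifs <;> omega
    · have := hβ'.2 y (List.mem_cons_of_mem _ hy)
      unfold veeRight
      split_ifs <;> omega

/-- The first `k` letters of `α ∨ β`, with `α` of size `k`. -/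
theorem mem_map_veeLeft {α : List ℕ} {b l x : ℕ} (hα : IsPermList α) (h1 : 1 ≤ α.length)
    (hb : 1 ≤ b) :
    x ∈ α.map (veeLeft (α.getD (α.length - 1) 0) b l) ↔
      (b ≤ x ∧ x ≤ α.getD (α.length - 1) 0 + b - 1) ∨
      (α.getD (α.length - 1) 0 + l ≤ x ∧ x + 1 ≤ α.length + l) := by
  have ha := hα.last_bounds h1
  generalize α.getD (α.length - 1) 0 = a at *
  simp only [List.mem_map, hα.mem_iff]
  constructor
  · rintro ⟨y, hy, rfl⟩
    unfold veeLeft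
    split_ifs <;> omega
  · rintro (h | h)
    · exact ⟨x + 1 - b, by omega, by unfold veeLeft; split_ifs <;> omega⟩
    · exact ⟨x + 1 - l, by omega, by unfold veeLeft; split_ifs <;> omega⟩

theorem getD_vee_last (α t : List ℕ) (b : ℕ) (h1 : 1 ≤ α.length) :
    (vee α (b :: t)).getD (α.length - 1) 0 = α.getD (α.length - 1) 0 + b - 1 := by
  rw [vee_cons, List.getD_append _ _ _ _ (by simp; omega),
    List.getD_eq_getElem _ _ (by simp; omega), List.getElem_map,
    ← List.getD_eq_getElem _ 0, veeLeft, if_pos le_rfl]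

theorem take_vee (α t : List ℕ) (b : ℕ) :
    (vee α (b :: t)).take α.length =
      α.map (veeLeft (α.getD (α.length - 1) 0) b (t.length + 1)) := by
  rw [vee_cons, List.take_left' (by simp)]

theorem CutWith.of_vee {α t : List ℕ} {b : ℕ} (hα : IsPermList α) (h1 : 1 ≤ α.length)
    (hβ : IsPermList (b :: t)) : CutWith (vee α (b :: t)) α.length b
      (α.getD (α.length - 1) 0 + (t.length + 1)) := by
  have hb := hβ.head_bounds
  have ha := hα.last_bounds h1
  refine ⟨hb.1, ?_, ?_, ?_, fun x => ?_⟩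
  · rw [getD_vee_last _ _ _ h1]
    omega
  · rw [getD_vee_last _ _ _ h1]
    omega
  · rw [length_vee_cons]
    omega
  · rw [take_vee, mem_map_veeLeft hα h1 hb.1, getD_vee_last _ _ _ h1, length_vee_cons]
    omega

theorem CutWith.left_unique {σ : List ℕ} {k p q p' q' : ℕ} (h : CutWith σ k p q)
    (h' : CutWith σ k p' q') : p = p' := by
  obtain ⟨h1, h2, h3, h4, h5⟩ := h
  obtain ⟨h1', h2', h3', h4', h5'⟩ := h'
  have e := (h5 (p - 1)).symm.trans (h5' (p - 1))
  have e' := (h5 (p' - 1)).symm.trans (h5' (p' - 1))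
  omega

theorem vee_inj {α α' t t' : List ℕ} {b b' : ℕ} (hα : IsPermList α) (hα' : IsPermList α')
    (hβ : IsPermList (b :: t)) (hβ' : IsPermList (b' :: t')) (h1 : 1 ≤ α.length)
    (hlen : α.length = α'.length) (h : vee α (b :: t) = vee α' (b' :: t')) :
    α = α' ∧ b = b' ∧ t = t' := by
  have c := CutWith.of_vee hα h1 hβ
  have c' := CutWith.of_vee hα' (hlen ▸ h1) hβ'
  rw [← h, ← hlen] at c'
  have hbb := c.left_unique c'
  subst hbb
  have hb := hβ.head_bounds
  have ha := hα.last_bounds h1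
  have ha' := hα'.last_bounds (hlen ▸ h1)
  have hl : t.length = t'.length := by
    have := congrArg List.length h
    simp only [length_vee_cons] at this
    omega
  have hlast : α.getD (α.length - 1) 0 = α'.getD (α'.length - 1) 0 := by
    have e := getD_vee_last α t b h1
    have e' := getD_vee_last α' t' b (hlen ▸ h1)
    have e'' : (vee α (b :: t)).getD (α.length - 1) 0 =
        (vee α' (b :: t')).getD (α'.length - 1) 0 := by rw [h, hlen]
    omega
  rw [vee_cons, vee_cons, ← hlast, ← hl] at h
  obtain ⟨e1, e2⟩ := List.append_inj h (by simpa using hlen)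
  exact ⟨List.map_injective_iff.2 (veeLeft_injective hb.1 hb.2) e1, rfl,
    List.map_injective_iff.2 (veeRight_injective ha.1) e2⟩

theorem secableAt_vee_iff {α t : List ℕ} {b j : ℕ} (hα : IsPermList α) (h1 : 1 ≤ α.length)
    (hβ : IsPermList (b :: t)) (hj : 1 ≤ j) (hjt : j ≤ t.length) :
    SecableAt (vee α (b :: t)) (α.length + j) ↔ SecableAt (b :: t) (j + 1) := by
  have hb := hβ.head_bounds
  have ha := hα.last_bounds h1
  rw [secableAt_iff (hα.vee_cons h1 hβ) (by omega) (by rw [length_vee_cons]; omega),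
    secableAt_iff hβ (by omega) (by simpa using hjt)]
  have hmemT : ∀ x, x ∈ (vee α (b :: t)).take (α.length + j) ↔
      x ∈ α.map (veeLeft (α.getD (α.length - 1) 0) b (t.length + 1)) ∨
      x ∈ (t.take j).map (veeRight (α.getD (α.length - 1) 0) b) := fun x => by
    have e := List.length_map (as := α)
      (veeLeft (α.getD (α.length - 1) 0) b (t.length + 1))
    rw [vee_cons, List.take_append, e, Nat.add_sub_cancel_left,
      List.take_of_length_le (by rw [e]; omega), List.mem_append, List.map_take]
  have hgetT : (vee α (b :: t)).getD (α.length + j - 1) 0 =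
      veeRight (α.getD (α.length - 1) 0) b (t.getD (j - 1) 0) := by
    rw [vee_cons, List.getD_append_right _ _ _ _ (by simp; omega), List.length_map,
      show α.length + j - 1 - α.length = j - 1 by omega,
      List.getD_eq_getElem _ _ (by simp; omega), List.getElem_map,
      List.getD_eq_getElem t _ (by omega)]
  have hget : (b :: t).getD (j + 1 - 1) 0 = t.getD (j - 1) 0 := by
    obtain ⟨i, rfl⟩ := Nat.exists_eq_add_of_le' hj
    simp
  have hwt : t.getD (j - 1) 0 ∈ t.take j := getD_pred_mem_take hj hjt
  have hβ' := isPermList_iff.1 hβ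
  simp only [List.nodup_cons, List.length_cons] at hβ'
  have htake : ∀ y ∈ t.take j, y ≠ b ∧ 1 ≤ y ∧ y ≤ t.length + 1 := fun y hy =>
    have hy := List.mem_of_mem_take hy
    ⟨fun e => hβ'.1.1 (e ▸ hy), hβ'.2 y (List.mem_cons_of_mem _ hy)⟩
  unfold CutWith
  rw [hgetT, hget, length_vee_cons]
  simp only [hmemT, mem_map_veeLeft hα h1 hb.1, List.take_succ_cons, List.mem_cons,
    List.length_cons]
  have hw := htake _ hwt
  generalize t.getD (j - 1) 0 = w at *
  generalize α.getD (α.length - 1) 0 = a at *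
  have hmap : ∀ x, x ∈ (t.take j).map (veeRight a b) ↔
      (x < b ∧ x ∈ t.take j) ∨ (a + b ≤ x ∧ x + 1 - a ∈ t.take j) := fun x => by
    rw [List.mem_map]
    constructor
    · rintro ⟨y, hy, rfl⟩
      have := htake y hy
      unfold veeRight
      split_ifs with hyb
      · exact .inl ⟨hyb, hy⟩
      · refine .inr ⟨by omega, ?_⟩
        rwa [show y + a - 1 + 1 - a = y by omega]
    · rintro (⟨hx, hy⟩ | ⟨hx, hy⟩)
      · exact ⟨x, hy, if_pos hx⟩
      · exact ⟨_, hy, by unfold veeRight; split_ifs <;> omega⟩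
  simp only [hmap]
  unfold veeRight
  constructor
  · rintro ⟨p, q, hp, hpw, hwq, hq, H⟩
    have Hb := (H b).1 (.inl (.inl ⟨le_rfl, by omega⟩))
    split_ifs at * with hwb
    · refine ⟨p, q, by omega, by omega, by omega, by omega, fun x => ?_⟩
      have H3 := htake x
      rcases lt_trichotomy x b with hx | rfl | hx
      · have H1 := H x
        have hx' : ¬ a + b ≤ x := by omega
        by_cases hm : x ∈ t.take j <;>
          simp only [hm, hx, hx', true_and, false_and, or_true, or_false,
            true_iff] at H1 ⊢ <;> omega
      · omega
      · have H2 := H (x + a - 1)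
        have hx' : ¬ x + a - 1 < b := by omega
        have hx'' : a + b ≤ x + a - 1 := by omega
        rw [show x + a - 1 + 1 - a = x by omega] at H2
        by_cases hm : x ∈ t.take j <;>
          simp only [hm, hx', hx'', true_and, false_and, or_true, or_false,
            true_iff, forall_const] at H2 H3 ⊢ <;> omega
    · refine ⟨p, min (q + 1 - a) (t.length + 2), by omega, by omega, by omega, by omega,
        fun x => ?_⟩
      have H3 := htake x
      rcases lt_trichotomy x b with hx | rfl | hx
      · have H1 := H x
        have hx' : ¬ a + b ≤ x := by omega
        by_cases hm : x ∈ t.take j <;>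
          simp only [hm, hx, hx', true_and, false_and, or_true, or_false,
            true_iff] at H1 ⊢ <;> omega
      · omega
      · have H2 := H (x + a - 1)
        have hx' : ¬ x + a - 1 < b := by omega
        have hx'' : a + b ≤ x + a - 1 := by omega
        rw [show x + a - 1 + 1 - a = x by omega] at H2
        by_cases hm : x ∈ t.take j <;>
          simp only [hm, hx', hx'', true_and, false_and, or_true, or_false,
            true_iff, forall_const] at H2 H3 ⊢ <;> omega
  · rintro ⟨p, q, hp, hpw, hwq, hq, H⟩
    have Hb := (H b).1 (.inl rfl)
    by_cases hwb : w < b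
    · simp only [if_pos hwb]
      refine ⟨p, q, by omega, by omega, by omega, by omega, fun x => ?_⟩
      by_cases hx : x < b
      · have H1 := H x
        have hx' : ¬ a + b ≤ x := by omega
        by_cases hm : x ∈ t.take j <;>
          simp only [hm, hx, hx', true_and, false_and, or_true, or_false,
            true_iff] at H1 ⊢ <;> omega
      by_cases hx' : a + b ≤ x
      · have H2 := H (x + 1 - a)
        have H3 := htake (x + 1 - a)
        by_cases hm : x + 1 - a ∈ t.take j <;>
          simp only [hm, hx, hx', true_and, false_and, or_true, or_false,
            true_iff, forall_const] at H2 H3 ⊢ <;> omega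
      · simp only [hx, hx', false_and, or_false]
        omega
    · simp only [if_neg hwb]
      refine ⟨p, q + a - 1, by omega, by omega, by omega, by omega, fun x => ?_⟩
      by_cases hx : x < b
      · have H1 := H x
        have hx' : ¬ a + b ≤ x := by omega
        by_cases hm : x ∈ t.take j <;>
          simp only [hm, hx, hx', true_and, false_and, or_true, or_false,
            true_iff] at H1 ⊢ <;> omega
      by_cases hx' : a + b ≤ x
      · have H2 := H (x + 1 - a)
        have H3 := htake (x + 1 - a)
        by_cases hm : x + 1 - a ∈ t.take j <;>
          simp only [hm, hx, hx', true_and, false_and, or_true, or_false,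
            true_iff, forall_const] at H2 H3 ⊢ <;> omega
      · simp only [hx, hx', false_and, or_false]
        omega

theorem CutWith.length_eq {σ : List ℕ} {k p q : ℕ} (hσ : IsPermList σ) (hk : k ≤ σ.length)
    (h : CutWith σ k p q) : k + p + q = σ.getD (k - 1) 0 + σ.length + 2 := by
  obtain ⟨h1, h2, h3, h4, h5⟩ := h
  have hS : (σ.take k).toFinset =
      Finset.Icc p (σ.getD (k - 1) 0) ∪ Finset.Icc q σ.length := by
    ext x
    simp [h5]
  have hd : Disjoint (Finset.Icc p (σ.getD (k - 1) 0)) (Finset.Icc q σ.length) := by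
    rw [Finset.disjoint_left]
    intro x hx hx'
    simp only [Finset.mem_Icc] at hx hx'
    omega
  have hc := congrArg Finset.card hS
  rw [List.toFinset_card_of_nodup ((isPermList_iff.1 hσ).1.sublist (List.take_sublist _ _)),
    Finset.card_union_of_disjoint hd, Nat.card_Icc, Nat.card_Icc, List.length_take] at hc
  omega

theorem exists_vee_of_cutWith {σ : List ℕ} {k p q : ℕ} (hσ : IsPermList σ) (hk : 1 ≤ k)
    (hkn : k ≤ σ.length) (h : CutWith σ k p q) :
    ∃ α b t, IsPermList α ∧ IsPermList (b :: t) ∧ α.length = k ∧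
      t.length = σ.length - k ∧ vee α (b :: t) = σ := by
  have hcount := h.length_eq hσ hkn
  obtain ⟨hp, hpw, hwq, hq, hmem⟩ := h
  have hnd := (isPermList_iff.1 hσ).1
  have hdrop : ∀ y ∈ σ.drop k, (1 ≤ y ∧ y < p) ∨ (σ.getD (k - 1) 0 < y ∧ y < q) := by
    intro y hy
    have hy' := hσ.mem_iff.1 (List.mem_of_mem_drop hy)
    have : y ∉ σ.take k := fun hyt =>
      List.disjoint_take_drop hnd le_rfl hyt hy
    rw [hmem] at this
    omega
  have hgetk : σ.getD (k - 1) 0 = σ[k - 1]'(by omega) := List.getD_eq_getElem _ _ (by omega)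
  have hlen : (σ.take k).length = k := by simpa using hkn
  set w := σ.getD (k - 1) 0
  set f : ℕ → ℕ := fun x => if x ≤ w then x + 1 - p else x + k - σ.length with hf
  set g : ℕ → ℕ := fun y => if y < p then y else y + p - w with hg
  have hlast : ((σ.take k).map f).getD (((σ.take k).map f).length - 1) 0 = w + 1 - p := by
    rw [List.getD_eq_getElem _ _ (by rw [List.length_map]; omega)]
    simp only [List.getElem_map, List.getElem_take, List.length_map, hlen, ← hgetk, hf,
      le_refl, if_true]
  refine ⟨(σ.take k).map f, p, (σ.drop k).map g, ?_, ?_, by simpa using hkn, by simp, ?_⟩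
  · rw [isPermList_iff, List.length_map, hlen]
    refine ⟨(hnd.sublist (List.take_sublist _ _)).map_on ?_, ?_⟩
    · intro x hx y hy hxy
      rw [hmem] at hx hy
      simp only [hf] at hxy
      split_ifs at hxy <;> omega
    · intro x hx
      obtain ⟨y, hy, rfl⟩ := List.mem_map.1 hx
      rw [hmem] at hy
      simp only [hf]
      split_ifs <;> omega
  · rw [isPermList_iff, List.nodup_cons, List.length_cons, List.length_map, List.length_drop]
    refine ⟨⟨?_, (hnd.sublist (List.drop_sublist _ _)).map_on ?_⟩, ?_⟩
    · intro hx
      obtain ⟨y, hy, e⟩ := List.mem_map.1 hx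
      have := hdrop y hy
      simp only [hg] at e
      split_ifs at e <;> omega
    · intro x hx y hy hxy
      have := hdrop x hx
      have := hdrop y hy
      simp only [hg] at hxy
      split_ifs at hxy <;> omega
    · intro x hx
      rcases List.mem_cons.1 hx with rfl | hx
      · omega
      · obtain ⟨y, hy, rfl⟩ := List.mem_map.1 hx
        have := hdrop y hy
        simp only [hg]
        split_ifs <;> omega
  · rw [vee_cons, hlast]
    conv_rhs => rw [← List.take_append_drop k σ]
    congr 1
    · rw [List.map_map]
      refine (List.map_congr_left fun x hx => ?_).trans (List.map_id _)
      rw [hmem] at hx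
      simp only [Function.comp, veeLeft, hf, List.length_map, List.length_drop, id]
      split_ifs <;> omega
    · rw [List.map_map]
      refine (List.map_congr_left fun y hy => ?_).trans (List.map_id _)
      have := hdrop y hy
      simp only [Function.comp, veeRight, hg, id]
      split_ifs <;> omega

theorem nonSecable_cons_iff {b : ℕ} {t : List ℕ} :
    NonSecable (b :: t) ↔ 1 ≤ t.length ∧ ∀ j, 1 ≤ j → j < t.length →
      ¬ SecableAt (b :: t) (j + 1) := by
  unfold NonSecable
  simp only [List.length_cons]
  refine and_congr (by omega) ⟨fun h j hj hjt => h _ (by omega) (by omega), fun h k hk hkt => ?_⟩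
  obtain ⟨j, rfl⟩ := Nat.exists_eq_add_of_le' (show 1 ≤ k by omega)
  exact h j (by omega) (by omega)

theorem exists_eq_cons_of_nonSecable {β : List ℕ} (h : NonSecable β) : ∃ b t, β = b :: t :=
  List.exists_cons_of_length_pos (by have := h.1; omega)

theorem secableAt_vee_length {α t : List ℕ} {b : ℕ} (hα : IsPermList α) (h1 : 1 ≤ α.length)
    (hβ : IsPermList (b :: t)) : SecableAt (vee α (b :: t)) α.length :=
  (secableAt_iff (hα.vee_cons h1 hβ) h1 (by rw [length_vee_cons]; omega)).2
    ⟨_, _, CutWith.of_vee hα h1 hβ⟩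

theorem not_nonSecable_vee {α β : List ℕ} (hα : IsPermList α) (h2 : 2 ≤ α.length)
    (hβ : IsPermList β) (hβn : NonSecable β) : ¬ NonSecable (vee α β) := by
  obtain ⟨b, t, rfl⟩ := exists_eq_cons_of_nonSecable hβn
  have := (nonSecable_cons_iff.1 hβn).1
  exact fun h => h.2 _ h2 (by rw [length_vee_cons]; omega)
    (secableAt_vee_length hα (by omega) hβ)

theorem length_le_of_vee_eq {α α' β β' : List ℕ} (hα : IsPermList α) (hα' : IsPermList α')
    (hβ : IsPermList β) (hβ' : IsPermList β') (h1 : 1 ≤ α.length) (h1' : 1 ≤ α'.length)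
    (hβn : NonSecable β) (hβn' : NonSecable β') (h : vee α β = vee α' β') :
    α'.length ≤ α.length := by
  obtain ⟨b, t, rfl⟩ := exists_eq_cons_of_nonSecable hβn
  obtain ⟨b', t', rfl⟩ := exists_eq_cons_of_nonSecable hβn'
  by_contra! hlt
  obtain ⟨j, hj⟩ := Nat.exists_eq_add_of_lt hlt
  have hs := secableAt_vee_length hα' h1' hβ'
  have hl := congrArg List.length h
  rw [length_vee_cons, length_vee_cons] at hl
  have ht' := (nonSecable_cons_iff.1 hβn').1
  rw [← h, hj, add_assoc, secableAt_vee_iff hα h1 hβ (by omega) (by omega)] at hs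
  exact (nonSecable_cons_iff.1 hβn).2 _ (by omega) (by omega) hs

theorem vee_inj_of_nonSecable {α α' β β' : List ℕ} (hα : IsPermList α)
    (hα' : IsPermList α') (hβ : IsPermList β) (hβ' : IsPermList β') (h1 : 1 ≤ α.length)
    (h1' : 1 ≤ α'.length) (hβn : NonSecable β) (hβn' : NonSecable β')
    (h : vee α β = vee α' β') : α = α' ∧ β = β' := by
  have hle := length_le_of_vee_eq hα hα' hβ hβ' h1 h1' hβn hβn' h
  have hge := length_le_of_vee_eq hα' hα hβ' hβ h1' h1 hβn' hβn h.symm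
  obtain ⟨b, t, rfl⟩ := exists_eq_cons_of_nonSecable hβn
  obtain ⟨b', t', rfl⟩ := exists_eq_cons_of_nonSecable hβn'
  obtain ⟨rfl, rfl, rfl⟩ := vee_inj hα hα' hβ hβ' h1 (hge.antisymm hle) h
  exact ⟨rfl, rfl⟩

theorem exists_vee_nonSecable {σ : List ℕ} (hσ : IsPermList σ) (h2 : 2 ≤ σ.length)
    (h : ¬ NonSecable σ) : ∃ α β, IsPermList α ∧ 2 ≤ α.length ∧ α.length < σ.length ∧
      IsPermList β ∧ NonSecable β ∧ vee α β = σ := by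
  classical
  let K := (Finset.range σ.length).filter fun k => 2 ≤ k ∧ SecableAt σ k
  have hK : K.Nonempty := by
    simp only [NonSecable, not_and, not_forall, not_not] at h
    obtain ⟨k, hk, hkn, hs⟩ := h h2
    exact ⟨k, by simp [K, hk, hkn, hs]⟩
  have hmax := K.max'_mem hK
  have hle : ∀ x ∈ K, x ≤ K.max' hK := fun x hx => K.le_max' x hx
  generalize K.max' hK = k at hmax hle
  simp only [K, Finset.mem_filter, Finset.mem_range] at hmax hle
  obtain ⟨hkn, hk, hs⟩ := hmax
  obtain ⟨p, q, hc⟩ := (secableAt_iff hσ (by omega) hkn.le).1 hs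
  obtain ⟨α, b, t, hα, hβ, rfl, ht, rfl⟩ :=
    exists_vee_of_cutWith hσ (by omega) hkn.le hc
  refine ⟨α, b :: t, hα, hk, hkn, hβ,
    nonSecable_cons_iff.2 ⟨by omega, fun j hj hjt hsj => ?_⟩, rfl⟩
  rw [← secableAt_vee_iff hα (by omega) hβ hj hjt.le] at hsj
  have := hle (α.length + j) ⟨by rw [length_vee_cons]; omega, by omega, hsj⟩
  omega

theorem IsPermList.foldl_vee {α : List ℕ} {L : List (List ℕ)} (hα : IsPermList α)
    (h2 : 2 ≤ α.length) (hL : ∀ τ ∈ L, IsPermList τ ∧ NonSecable τ) :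
    IsPermList (L.foldl vee α) ∧ 2 ≤ (L.foldl vee α).length := by
  induction L generalizing α with
  | nil => exact ⟨hα, h2⟩
  | cons β L ih =>
    obtain ⟨hβ, hβn⟩ := hL β List.mem_cons_self
    obtain ⟨b, t, rfl⟩ := exists_eq_cons_of_nonSecable hβn
    exact ih (hα.vee_cons (by omega) hβ) (by rw [length_vee_cons]; omega)
      fun τ hτ => hL τ (List.mem_cons_of_mem _ hτ)

theorem exists_foldl_vee {σ : List ℕ} (hσ : IsPermList σ) (h2 : 2 ≤ σ.length) :
    ∃ p : List ℕ × List (List ℕ), (IsPermList p.1 ∧ NonSecable p.1) ∧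
      (∀ τ ∈ p.2, IsPermList τ ∧ NonSecable τ) ∧ p.2.foldl vee p.1 = σ := by
  induction hn : σ.length using Nat.strong_induction_on generalizing σ with
  | _ n ih =>
    by_cases hs : NonSecable σ
    · exact ⟨(σ, []), ⟨hσ, hs⟩, by simp, rfl⟩
    · obtain ⟨α, β, hα, hα2, hlt, hβ, hβn, rfl⟩ := exists_vee_nonSecable hσ h2 hs
      obtain ⟨⟨π, L⟩, hπ, hL, rfl⟩ := ih _ (hn ▸ hlt) hα hα2 rfl
      refine ⟨(π, L ++ [β]), hπ, fun τ hτ => ?_, by simp⟩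
      rcases List.mem_append.1 hτ with hτ | hτ
      · exact hL τ hτ
      · obtain rfl := List.mem_singleton.1 hτ
        exact ⟨hβ, hβn⟩

theorem foldl_vee_inj {α α' : List ℕ} {L L' : List (List ℕ)} (hα : IsPermList α)
    (hα' : IsPermList α') (hαn : NonSecable α) (hαn' : NonSecable α')
    (hL : ∀ τ ∈ L, IsPermList τ ∧ NonSecable τ) (hL' : ∀ τ ∈ L', IsPermList τ ∧ NonSecable τ)
    (h : L.foldl vee α = L'.foldl vee α') : α = α' ∧ L = L' := by
  induction L using List.reverseRecOn generalizing L' with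
  | nil =>
    rcases List.eq_nil_or_concat' L' with rfl | ⟨M', β', rfl⟩
    · exact ⟨h, rfl⟩
    · simp only [List.mem_append, List.mem_singleton, or_imp, forall_and, forall_eq] at hL'
      obtain ⟨hf, hf2⟩ := hα'.foldl_vee hαn'.1 fun τ hτ => ⟨hL'.1.1 τ hτ, hL'.2.1 τ hτ⟩
      simp only [List.foldl_append, List.foldl_cons, List.foldl_nil] at h
      exact absurd (h ▸ hαn) (not_nonSecable_vee hf hf2 hL'.1.2 hL'.2.2)
  | append_singleton M β ih =>
    simp only [List.mem_append, List.mem_singleton, or_imp, forall_and, forall_eq] at hL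
    have hM := fun τ hτ => And.intro (hL.1.1 τ hτ) (hL.2.1 τ hτ)
    obtain ⟨hf, hf2⟩ := hα.foldl_vee hαn.1 hM
    simp only [List.foldl_append, List.foldl_cons, List.foldl_nil] at h
    rcases List.eq_nil_or_concat' L' with rfl | ⟨M', β', rfl⟩
    · exact absurd (h ▸ hαn') (not_nonSecable_vee hf hf2 hL.1.2 hL.2.2)
    · simp only [List.mem_append, List.mem_singleton, or_imp, forall_and, forall_eq] at hL'
      have hM' := fun τ hτ => And.intro (hL'.1.1 τ hτ) (hL'.2.1 τ hτ)
      obtain ⟨hf', hf2'⟩ := hα'.foldl_vee hαn'.1 hM'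
      simp only [List.foldl_append, List.foldl_cons, List.foldl_nil] at h
      obtain ⟨e, rfl⟩ := vee_inj_of_nonSecable hf hf' hL.1.2 hL'.1.2 (by omega) (by omega)
        hL.2.2 hL'.2.2 h
      obtain ⟨rfl, rfl⟩ := ih hM hM' e
      exact ⟨rfl, rfl⟩

/-- every permutation `σ` of size `n ≥ 2` admits a unique decomposition
`σ = σ₁ ∨ σ₂ ∨ … ∨ σ_r` (the operation `∨` applied left-nestedly, encoded as the pair
`(σ₁, [σ₂,…,σ_r])` and a left fold) in which every factor `σ_i` is a non-secable
permutation. -/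
theorem unique_vee_factorization (σ : List ℕ) (hσ : IsPermList σ) (h2 : 2 ≤ σ.length) :
    ∃! p : List ℕ × List (List ℕ),
      (IsPermList p.1 ∧ NonSecable p.1) ∧
      (∀ τ ∈ p.2, IsPermList τ ∧ NonSecable τ) ∧
      p.2.foldl vee p.1 = σ := by
  obtain ⟨p, hp, hL, h⟩ := exists_foldl_vee hσ h2
  refine ⟨p, ⟨hp, hL, h⟩, fun p' ⟨hp', hL', h'⟩ => ?_⟩
  obtain ⟨e1, e2⟩ := foldl_vee_inj hp'.1 hp.1 hp'.2 hp.2 hL' hL (h'.trans h.symm)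
  exact Prod.ext e1 e2
end

section
/- For packed words u of length k and v of length l, the set u # v is exactly the interval [u∧v, u∨v] of the pseudo-permutohedron order on packed words of length k+l−1: a packed word w of length k+l−1 satisfies pack(w_1…w_k) = u and pack(w_k…w_{k+l−1}) = v if and only if u∧v ≤ w ≤ u∨v. -/
/-- The packed word of `u`: if the distinct letters of `u` are `b₁ < b₂ < … < b_r`,
then `pack u` is the image of `u` under the substitution `b_i ↦ i`. -/
def pack (u : List ℕ) : List ℕ :=
  u.map (fun x => (u.toFinset.filter (fun y => y ≤ x)).card)

/-- A word is packed if it is its own packed word. -/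
def IsPacked (u : List ℕ) : Prop := pack u = u

/-- The largest letter of a word. -/
def maxL (u : List ℕ) : ℕ := u.foldr max 0

/-- The packed word `u ∨ v` (lengths `k`, `l`): the first `k` letters are
`u_i + v₁ − 1` if `u_i ≤ u_k` and `u_i + max(v) − 1` if `u_i > u_k`, followed, for
`2 ≤ i ≤ l`, by `v_i` if `v_i < v₁` and `v_i + u_k − 1` if `v_i ≥ v₁`. -/
def veeP (u v : List ℕ) : List ℕ :=
  (u.map (fun x => if x ≤ u.getD (u.length - 1) 0 then x + v.getD 0 0 - 1
      else x + maxL v - 1)) ++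
    ((v.drop 1).map (fun y => if y < v.getD 0 0 then y
      else y + u.getD (u.length - 1) 0 - 1))

/-- The packed word `u ∧ v` (lengths `k`, `l`): the first `k` letters are `u_i` if
`u_i < u_k` and `u_i + v₁ − 1` if `u_i ≥ u_k`, followed, for `2 ≤ i ≤ l`, by
`v_i + u_k − 1` if `v_i ≤ v₁` and `v_i + max(u) − 1` if `v_i > v₁`. -/
def wedgeP (u v : List ℕ) : List ℕ :=
  (u.map (fun x => if x < u.getD (u.length - 1) 0 then x
      else x + v.getD 0 0 - 1)) ++
    ((v.drop 1).map (fun y => if y ≤ v.getD 0 0 then y + u.getD (u.length - 1) 0 - 1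
      else y + maxL u - 1))

/-- The generalized inversion coefficient of the pair of positions `(i,j)`, `i < j`
(1-indexed): `1` for a full inversion (`w_i > w_j`), `1/2` for a half inversion
(`w_i = w_j`), and `0` otherwise. -/
def cij (w : List ℕ) (i j : ℕ) : ℚ :=
  if w.getD (j - 1) 0 < w.getD (i - 1) 0 then 1
  else if w.getD (i - 1) 0 = w.getD (j - 1) 0 then 1/2
  else 0

/-- The pseudo-permutohedron order on packed words of the same length:
`u ≤ v` iff every generalized inversion coefficient of `u` is at most that of `v`. -/
def pseudoLe (u v : List ℕ) : Prop :=
  ∀ i j, 1 ≤ i → i < j → j ≤ u.length → cij u i j ≤ cij v i j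

theorem length_pack (u : List ℕ) : (pack u).length = u.length := by simp [pack]

theorem getD_pack (u : List ℕ) (i : ℕ) (hi : i < u.length) :
    (pack u).getD i 0 = (u.toFinset.filter (fun y => y ≤ u.getD i 0)).card := by
  simp [pack, hi]

theorem getD_mem_toFinset (u : List ℕ) (i : ℕ) (hi : i < u.length) :
    u.getD i 0 ∈ u.toFinset := by
  simp [hi]

/-- Packing preserves the relative order of any two letters. -/
theorem getD_pack_lt_iff (u : List ℕ) (i j : ℕ) (hi : i < u.length) (hj : j < u.length) :
    (pack u).getD i 0 < (pack u).getD j 0 ↔ u.getD i 0 < u.getD j 0 := by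
  rw [getD_pack u i hi, getD_pack u j hj]
  constructor
  · intro h
    by_contra! hle
    refine absurd (Finset.card_le_card ?_) (not_le.mpr h)
    exact Finset.monotone_filter_right _ (fun y _ hy => le_trans hy hle)
  · intro h
    apply Finset.card_lt_card
    rw [Finset.ssubset_iff_of_subset
      (Finset.monotone_filter_right _ (fun y _ hy => le_trans hy h.le))]
    refine ⟨u.getD j 0, Finset.mem_filter.mpr ⟨getD_mem_toFinset u j hj, le_rfl⟩, ?_⟩
    intro hmem
    exact absurd (Finset.mem_filter.mp hmem).2 (not_le.mpr h)

/-- The letters of `b` up to its `i`-th one are at least as many as those of `a`, when the two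
words have the same relative order. -/
theorem card_filter_le_of_getD_lt_iff (a b : List ℕ) (hlen : a.length = b.length)
    (h : ∀ i j, i < a.length → j < a.length →
      (a.getD i 0 < a.getD j 0 ↔ b.getD i 0 < b.getD j 0)) (i : ℕ) (hi : i < a.length) :
    (a.toFinset.filter (fun y => y ≤ a.getD i 0)).card ≤
      (b.toFinset.filter (fun y => y ≤ b.getD i 0)).card := by
  have idx : ∀ x ∈ a.toFinset, a.idxOf x < a.length ∧ a.getD (a.idxOf x) 0 = x := by
    intro x hx
    have hlt := List.idxOf_lt_length_of_mem (List.mem_toFinset.mp hx)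
    exact ⟨hlt, by simp [hlt]⟩
  apply Finset.card_le_card_of_injOn (fun x => b.getD (a.idxOf x) 0)
  · intro x hx
    obtain ⟨hxa, hxi⟩ := Finset.mem_filter.mp hx
    obtain ⟨hlt, hget⟩ := idx x hxa
    refine Finset.mem_filter.mpr ⟨getD_mem_toFinset b _ (hlen ▸ hlt), ?_⟩
    have := h i _ hi hlt
    dsimp only
    omega
  · intro x hx y hy hxy
    obtain ⟨hx₁, hx₂⟩ := idx x (Finset.mem_filter.mp hx).1
    obtain ⟨hy₁, hy₂⟩ := idx y (Finset.mem_filter.mp hy).1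
    have h₁ := h _ _ hx₁ hy₁
    have h₂ := h _ _ hy₁ hx₁
    dsimp only at hxy
    omega

theorem pack_eq_pack_of_getD_lt_iff (a b : List ℕ) (hlen : a.length = b.length)
    (h : ∀ i j, i < a.length → j < a.length →
      (a.getD i 0 < a.getD j 0 ↔ b.getD i 0 < b.getD j 0)) : pack a = pack b := by
  refine List.ext_getElem (by simp [length_pack, hlen]) fun i h₁ h₂ => ?_
  have ha : i < a.length := by simpa [length_pack] using h₁
  have key : (pack a).getD i 0 = (pack b).getD i 0 := by
    rw [getD_pack a i ha, getD_pack b i (hlen ▸ ha)]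
    refine le_antisymm (card_filter_le_of_getD_lt_iff a b hlen h i ha)
      (card_filter_le_of_getD_lt_iff b a hlen.symm (fun p q hp hq => ?_) i (hlen ▸ ha))
    exact (h p q (hlen ▸ hp) (hlen ▸ hq)).symm
  simpa [h₁, h₂] using key

/-- A word packs to the packed word `u` exactly when it has the relative order of `u`. -/
theorem IsPacked.pack_eq_iff {u : List ℕ} (hu : IsPacked u) (a : List ℕ)
    (hlen : a.length = u.length) :
    pack a = u ↔ ∀ i j, i < u.length → j < u.length →
      (a.getD i 0 < a.getD j 0 ↔ u.getD i 0 < u.getD j 0) := by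
  constructor
  · rintro rfl i j hi hj
    rw [length_pack] at hi hj
    exact (getD_pack_lt_iff a i j hi hj).symm
  · intro h
    rw [pack_eq_pack_of_getD_lt_iff a u hlen (by rwa [hlen])]
    exact hu

theorem IsPacked.one_le_getD {u : List ℕ} (hu : IsPacked u) (i : ℕ) (hi : i < u.length) :
    1 ≤ u.getD i 0 := by
  rw [← show pack u = u from hu, getD_pack u i hi]
  exact Finset.card_pos.mpr
    ⟨u.getD i 0, Finset.mem_filter.mpr ⟨getD_mem_toFinset u i hi, le_rfl⟩⟩

theorem getD_le_maxL (u : List ℕ) (i : ℕ) : u.getD i 0 ≤ maxL u := by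
  induction u generalizing i with
  | nil => simp
  | cons x u ih =>
    cases i with
    | zero => simp [maxL]
    | succ i =>
      have := ih i
      simp only [maxL, List.foldr_cons, List.getD_cons_succ] at this ⊢
      omega

theorem cij_le_cij_iff (a b : List ℕ) (i j : ℕ) :
    cij a i j ≤ cij b i j ↔
      (a.getD (j - 1) 0 < a.getD (i - 1) 0 → b.getD (j - 1) 0 < b.getD (i - 1) 0) ∧
      (a.getD (i - 1) 0 = a.getD (j - 1) 0 → b.getD (j - 1) 0 ≤ b.getD (i - 1) 0) := by
  unfold cij
  generalize a.getD (i - 1) 0 = p, a.getD (j - 1) 0 = q, b.getD (i - 1) 0 = r,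
    b.getD (j - 1) 0 = t
  split_ifs <;> norm_num <;> omega

theorem pseudoLe_iff (a b : List ℕ) :
    pseudoLe a b ↔ ∀ i j, i < j → j < a.length →
      (a.getD j 0 < a.getD i 0 → b.getD j 0 < b.getD i 0) ∧
      (a.getD i 0 = a.getD j 0 → b.getD j 0 ≤ b.getD i 0) := by
  simp only [pseudoLe, cij_le_cij_iff]
  constructor
  · intro h i j hij hj
    simpa using h (i + 1) (j + 1) (by omega) (by omega) hj
  · intro h i j hi hij hj
    exact h (i - 1) (j - 1) (by omega) (by omega)

theorem getD_map_append_map_drop_of_lt (f g : ℕ → ℕ) (u v : List ℕ) (p : ℕ)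
    (hp : p < u.length) :
    (u.map f ++ (v.drop 1).map g).getD p 0 = f (u.getD p 0) := by
  simp [List.getD_eq_getElem?_getD, List.getElem?_append, hp]

theorem getD_map_append_map_drop_of_le (f g : ℕ → ℕ) (u v : List ℕ) (q : ℕ)
    (hq : 1 ≤ q) (hqv : q < v.length) (hu : 1 ≤ u.length) :
    (u.map f ++ (v.drop 1).map g).getD (u.length - 1 + q) 0 = g (v.getD q 0) := by
  have h₁ : ¬ (u.length - 1 + q < u.length) := by omega
  have h₂ : u.length - 1 + q - u.length + 1 = q := by omega
  simp [List.getD_eq_getElem?_getD, List.getElem?_append, h₁, h₂, hqv]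

theorem length_veeP (u v : List ℕ) (hv : 1 ≤ v.length) :
    (veeP u v).length = u.length + v.length - 1 := by
  simp [veeP]; omega

theorem length_wedgeP (u v : List ℕ) (hv : 1 ≤ v.length) :
    (wedgeP u v).length = u.length + v.length - 1 := by
  simp [wedgeP]; omega

/-- for packed words `u` of length `k` and `v` of length `l`, the set
`u # v` is exactly the interval `[u∧v, u∨v]` of the pseudo-permutohedron order on
packed words of length `k+l−1`: a packed word `w` of length `k+l−1` satisfies
`pack (w₁…w_k) = u` and `pack (w_k…w_{k+l−1}) = v` if and only if
`u∧v ≤ w ≤ u∨v`. -/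
theorem packed_hash_is_interval (k l : ℕ) (hk : 1 ≤ k) (hl : 1 ≤ l)
    (u v : List ℕ) (hu : IsPacked u) (hul : u.length = k)
    (hv : IsPacked v) (hvl : v.length = l)
    (w : List ℕ) (hw : IsPacked w) (hwl : w.length = k + l - 1) :
    (pack (w.take k) = u ∧ pack (w.drop (k - 1)) = v) ↔
      (pseudoLe (wedgeP u v) w ∧ pseudoLe w (veeP u v)) := by
  rw [hu.pack_eq_iff _ (by simp; omega), hv.pack_eq_iff _ (by simp; omega),
    pseudoLe_iff, pseudoLe_iff, length_wedgeP u v (by omega), hwl, hul, hvl]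
  have take_get : ∀ i, i < k → (w.take k).getD i 0 = w.getD i 0 := by
    intro i hi
    simp [List.getD_eq_getElem?_getD, hi]
  have drop_get : ∀ i, (w.drop (k - 1)).getD i 0 = w.getD (k - 1 + i) 0 := by
    intro i
    simp [List.getD_eq_getElem?_getD]
  have upos : ∀ i, i < k → 1 ≤ u.getD i 0 := fun i hi => hu.one_le_getD i (by omega)
  have vpos : ∀ i, i < l → 1 ≤ v.getD i 0 := fun i hi => hv.one_le_getD i (by omega)
  have umax := getD_le_maxL u
  have vmax := getD_le_maxL v
  have vee_left : ∀ p, p < k → (veeP u v).getD p 0 =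
      if u.getD p 0 ≤ u.getD (k - 1) 0 then u.getD p 0 + v.getD 0 0 - 1
      else u.getD p 0 + maxL v - 1 := by
    intro p hp
    rw [veeP, getD_map_append_map_drop_of_lt _ _ _ _ _ (by omega), hul]
  have wedge_left : ∀ p, p < k → (wedgeP u v).getD p 0 =
      if u.getD p 0 < u.getD (k - 1) 0 then u.getD p 0
      else u.getD p 0 + v.getD 0 0 - 1 := by
    intro p hp
    rw [wedgeP, getD_map_append_map_drop_of_lt _ _ _ _ _ (by omega), hul]
  have vee_right : ∀ q, q < l → (veeP u v).getD (k - 1 + q) 0 =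
      if v.getD q 0 < v.getD 0 0 then v.getD q 0
      else v.getD q 0 + u.getD (k - 1) 0 - 1 := by
    intro q hq
    rcases Nat.eq_zero_or_pos q with rfl | hq0
    · rw [Nat.add_zero, vee_left _ (by omega)]
      simp [Nat.add_comm]
    · subst hul
      rw [veeP, getD_map_append_map_drop_of_le _ _ _ _ _ hq0 (by omega) hk]
  have wedge_right : ∀ q, q < l → (wedgeP u v).getD (k - 1 + q) 0 =
      if v.getD q 0 ≤ v.getD 0 0 then v.getD q 0 + u.getD (k - 1) 0 - 1
      else v.getD q 0 + maxL u - 1 := by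
    intro q hq
    rcases Nat.eq_zero_or_pos q with rfl | hq0
    · rw [Nat.add_zero, wedge_left _ (by omega)]
      simp [Nat.add_comm]
    · subst hul
      rw [wedgeP, getD_map_append_map_drop_of_le _ _ _ _ _ hq0 (by omega) hk]
  have uk := upos (k - 1) (by omega)
  have v0 := vpos 0 (by omega)
  constructor
  · rintro ⟨hU, hV⟩
    replace hU : ∀ i j, i < k → j < k →
        (w.getD i 0 < w.getD j 0 ↔ u.getD i 0 < u.getD j 0) := by
      intro i j hi hj
      rw [← hU i j hi hj, take_get i hi, take_get j hj]
    simp only [drop_get] at hV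
    rw [← forall_and]; intro i
    rw [← forall_and]; intro j
    rw [← forall_and]; intro hij
    rw [← forall_and]; intro hj
    by_cases hjk : j < k
    · have h₁ := hU i j (by omega) hjk
      have h₂ := hU j i hjk (by omega)
      have := upos i (by omega)
      have := upos j hjk
      have := umax i
      have := umax j
      have := vmax 0
      rw [vee_left i (by omega), vee_left j hjk, wedge_left i (by omega), wedge_left j hjk]
      split_ifs <;> omega
    obtain ⟨q, rfl⟩ : ∃ q, j = k - 1 + q := ⟨j - (k - 1), by omega⟩
    have hq : q < l := by omega
    have := vpos q hq
    have := vmax q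
    rw [vee_right q hq, wedge_right q hq]
    by_cases hik : i < k
    · have h₁ := hU i (k - 1) hik (by omega)
      have h₂ := hU (k - 1) i (by omega) hik
      have h₃ := hV 0 q (by omega) hq
      have h₄ := hV q 0 hq (by omega)
      have := upos i hik
      have := umax i
      rw [vee_left i hik, wedge_left i hik]
      simp only [Nat.add_zero] at h₃ h₄
      split_ifs <;> omega
    · obtain ⟨p, rfl⟩ : ∃ p, i = k - 1 + p := ⟨i - (k - 1), by omega⟩
      have hp : p < l := by omega
      have h₁ := hV p q hp hq
      have h₂ := hV q p hq hp
      have := vpos p hp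
      have := vmax p
      have := umax (k - 1)
      rw [vee_right p hp, wedge_right p hp]
      split_ifs <;> omega
  · rintro ⟨hA, hB⟩
    constructor
    · have key : ∀ i j, i < j → j < k →
          (w.getD i 0 < w.getD j 0 ↔ u.getD i 0 < u.getD j 0) ∧
          (w.getD j 0 < w.getD i 0 ↔ u.getD j 0 < u.getD i 0) := by
        intro i j hij hj
        have h₁ := hA i j hij (by omega)
        have h₂ := hB i j hij (by omega)
        have := upos i (by omega)
        have := upos j hj
        have := vmax 0
        rw [wedge_left i (by omega), wedge_left j hj] at h₁
        rw [vee_left i (by omega), vee_left j hj] at h₂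
        split_ifs at h₁ h₂ <;> omega
      intro i j hi hj
      rw [take_get i hi, take_get j hj]
      rcases lt_trichotomy i j with h | rfl | h
      · exact (key i j h hj).1
      · simp
      · exact (key j i h hi).2
    · have key : ∀ i j, i < j → j < l →
          (w.getD (k - 1 + i) 0 < w.getD (k - 1 + j) 0 ↔ v.getD i 0 < v.getD j 0) ∧
          (w.getD (k - 1 + j) 0 < w.getD (k - 1 + i) 0 ↔ v.getD j 0 < v.getD i 0) := by
        intro i j hij hj
        have h₁ := hA (k - 1 + i) (k - 1 + j) (by omega) (by omega)
        have h₂ := hB (k - 1 + i) (k - 1 + j) (by omega) (by omega)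
        have := vpos i (by omega)
        have := vpos j hj
        have := umax (k - 1)
        rw [wedge_right i (by omega), wedge_right j hj] at h₁
        rw [vee_right i (by omega), vee_right j hj] at h₂
        split_ifs at h₁ h₂ <;> omega
      intro i j hi hj
      rw [drop_get, drop_get]
      rcases lt_trichotomy i j with h | rfl | h
      · exact (key i j h hj).1
      · simp
      · exact (key j i h hi).2
end
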